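/- Let H_1 be an r×n matrix and H_2 an invertible n×n matrix over F_{q^2} with H_1 H_1^† invertible. Then the 2×2 block matrix [[H_1 H_1^†, H_1 H_2^†],[H_2 H_1^†, H_2 H_2^† + I_n]] is invertible if and only if the matrix I_n + (H_2^† H_2)^{-1} − H_1^†(H_1 H_1^†)^{-1} H_1 is invertible. -/

import Mathlib

/-- Conjugate transpose with respect to the Frobenius `x ↦ x ^ q`. -/
def dag {F : Type*} [Field F] (q : ℕ) {m n : Type*} (A : Matrix m n F) : Matrix n m F :=
  Matrix.of fun i j => A j i ^ q

/-- If `q ^ 2` is the cardinality of a finite field, then `x ↦ x ^ q` is a ring homomorphism. -/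
theorem exists_ringHom_eq_pow {F : Type*} [Field F] [Fintype F] {q : ℕ}
    (hq : Fintype.card F = q ^ 2) : ∃ f : F →+* F, ∀ x, f x = x ^ q := by
  obtain ⟨p, hp⟩ := CharP.exists F
  obtain ⟨k, hprime, hk⟩ := FiniteField.card F p
  obtain ⟨j, -, rfl⟩ := (Nat.dvd_prime_pow hprime).1
    (show q ∣ p ^ (k : ℕ) from hk ▸ hq ▸ dvd_pow_self q two_ne_zero)
  have : ExpChar F p := ExpChar.prime hprime
  exact ⟨iterateFrobenius F p j, iterateFrobenius_def p j⟩

theorem isUnit_dag {F : Type*} [Field F] [Fintype F] {q : ℕ} (hq : Fintype.card F = q ^ 2)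
    {m : Type*} [Fintype m] [DecidableEq m] {A : Matrix m m F} (hA : IsUnit A) :
    IsUnit (dag q A) := by
  obtain ⟨f, hf⟩ := exists_ringHom_eq_pow hq
  have hdag : dag q A = (f.mapMatrix A).transpose := by
    ext i j
    simp [dag, hf]
  rw [hdag, Matrix.isUnit_transpose]
  exact hA.map f.mapMatrix

/-- Block-matrix computation: with `H₁H₁†` and `H₂` invertible, the matrix
`[[H₁H₁†, H₁H₂†], [H₂H₁†, H₂H₂† + I]]` is invertible iff
`I + (H₂†H₂)⁻¹ − H₁†(H₁H₁†)⁻¹H₁` is invertible. -/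
theorem stmt10 {F : Type*} [Field F] [Fintype F] (q r n : ℕ)
    (hq : Fintype.card F = q ^ 2)
    (H1 : Matrix (Fin r) (Fin n) F) (H2 : Matrix (Fin n) (Fin n) F)
    (h1 : IsUnit (H1 * dag q H1)) (h2 : IsUnit H2) :
    IsUnit (Matrix.fromBlocks (H1 * dag q H1) (H1 * dag q H2)
        (H2 * dag q H1) (H2 * dag q H2 + 1))
      ↔ IsUnit (1 + (dag q H2 * H2)⁻¹ - dag q H1 * (H1 * dag q H1)⁻¹ * H1) := by
  have h2' := isUnit_dag hq h2
  have := h1.invertible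
  have hschur : H2 * dag q H2 + 1 - H2 * dag q H1 * (H1 * dag q H1)⁻¹ * (H1 * dag q H2) =
      H2 * (1 + (dag q H2 * H2)⁻¹ - dag q H1 * (H1 * dag q H1)⁻¹ * H1) * dag q H2 := by
    have hcancel : H2 * (dag q H2 * H2)⁻¹ * dag q H2 = 1 := by
      rw [Matrix.mul_inv_rev, Matrix.mul_nonsing_inv_cancel_left _ _
        ((Matrix.isUnit_iff_isUnit_det _).1 h2),
        Matrix.nonsing_inv_mul _ ((Matrix.isUnit_iff_isUnit_det _).1 h2')]
    rw [Matrix.mul_sub, Matrix.mul_add, Matrix.sub_mul, Matrix.add_mul, hcancel, Matrix.mul_one]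
    simp only [Matrix.mul_assoc]
  rw [Matrix.isUnit_fromBlocks_iff_of_invertible₁₁, Matrix.invOf_eq_nonsing_inv, hschur,
    h2'.mul_right_iff, h2.mul_left_iff]
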